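/- For each integer n ≥ 2, there exists a constant C > 0, depending only on n, such that for every integer k ≥ 1, c(n,k) ≥ C · k^{(n−1)/(n+1)}. -/

import Mathlib

open Pointwise

noncomputable section

/-- The set of lattice (integer) points in `ℝ^n`. -/
def lat (n : ℕ) : Set (Fin n → ℝ) := {x | ∀ j, ∃ z : ℤ, x j = (z : ℝ)}

/-- The polyhedron determined by the subsystem of `A x ≤ b` indexed by `I`. -/
def polyI {n m : ℕ} (A : Fin m → Fin n → ℝ) (b : Fin m → ℝ) (I : Set (Fin m)) :
    Set (Fin n → ℝ) := {x | ∀ i ∈ I, ∑ j, A i j * x j ≤ b i}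

/-- The integer points of a set `S ⊆ ℝ^n`. -/
def intPts {n : ℕ} (S : Set (Fin n → ℝ)) : Set (Fin n → ℝ) := S ∩ lat n

/-- `c` is a valid Helly-type bound for dimension `n` and `k` integer points:
any polyhedron with exactly `k` integer points has a subsystem of at most `c`
inequalities with exactly the same integer points. -/
def HellyBound (n k c : ℕ) : Prop :=
  ∀ (m : ℕ) (A : Fin m → Fin n → ℝ) (b : Fin m → ℝ),
    (intPts (polyI A b Set.univ)).Finite →
    (intPts (polyI A b Set.univ)).ncard = k →
    ∃ I : Finset (Fin m), I.card ≤ c ∧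
      intPts (polyI A b (↑I : Set (Fin m))) = intPts (polyI A b Set.univ)

/-- The quantity `c(n,k)`: the least valid Helly-type bound. -/
def cnk (n k : ℕ) : ℕ := sInf {c | HellyBound n k c}

/-- A set of points is in convex position if no point of it lies in the convex
hull of the others. -/
def ConvexPos {n : ℕ} (V : Set (Fin n → ℝ)) : Prop :=
  ∀ v ∈ V, v ∉ convexHull ℝ (V \ {v})

/-- `iconv V = conv(V) ∩ ℤ^n`. -/
def iconv {n : ℕ} (V : Set (Fin n → ℝ)) : Set (Fin n → ℝ) :=
  convexHull ℝ V ∩ lat n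

/-- `ℓ(n,k)`: the smallest integer `s` such that every set `V ⊆ ℤ^n` in convex
position with `|V| = s` satisfies `|iconv(V) \ V| ≥ k`. -/
def ellnk (n k : ℕ) : ℕ :=
  sInf {s | ∀ V : Set (Fin n → ℝ), V ⊆ lat n → ConvexPos V → V.Finite →
    V.ncard = s → k ≤ (iconv V \ V).ncard}

/-- The set of midpoints of `V` that are not in `V`. -/
def midpts {n : ℕ} (V : Set (Fin n → ℝ)) : Set (Fin n → ℝ) :=
  {p | ∃ x ∈ V, ∃ y ∈ V, p = (1/2 : ℝ) • (x + y)} \ V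

/-- `μ_c(n,s)`: the minimum number of midpoints `|M(V)|` over all sets
`V ⊆ ℝ^n` in convex position with `|V| = s`. -/
def muc (n s : ℕ) : ℕ :=
  sInf {m | ∃ V : Set (Fin n → ℝ), ConvexPos V ∧ V.Finite ∧ V.ncard = s ∧
    (midpts V).ncard = m}

/-- `α(n,k)`: the maximum cardinality of a set `V ⊆ ℤ^n` in convex position
with `|iconv(V) \ V| = k`. -/
def alphank (n k : ℕ) : ℕ :=
  sSup {m | ∃ V : Set (Fin n → ℝ), V ⊆ lat n ∧ ConvexPos V ∧ V.Finite ∧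
    V.ncard = m ∧ (iconv V \ V).ncard = k}

/-- A system `A x ≤ b` is non-redundant if removing any single inequality
strictly increases the set of integer points. -/
def NonRedundant {n m : ℕ} (A : Fin m → Fin n → ℝ) (b : Fin m → ℝ) : Prop :=
  ∀ i : Fin m,
    intPts (polyI A b Set.univ) ⊂ intPts (polyI A b ({i}ᶜ : Set (Fin m)))

/-- The set of lattice (integer) points in Euclidean space `ℝ^n`. -/
def latE (n : ℕ) : Set (EuclideanSpace ℝ (Fin n)) := {x | ∀ j, ∃ z : ℤ, x j = (z : ℝ)}


/-- Value of a linear form on an integer vector. -/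
def gval {n : ℕ} (a : Fin n → ℝ) (x : Fin n → ℤ) : ℝ := ∑ j, a j * (x j : ℝ)

/-- Cast an integer vector to a real vector. -/
def castV {n : ℕ} (x : Fin n → ℤ) : Fin n → ℝ := fun j => (x j : ℝ)

lemma castV_inj {n : ℕ} : Function.Injective (castV (n := n)) := by
  intro x y h
  funext j
  have := congrFun h j
  simpa [castV] using this

lemma mem_lat_iff {n : ℕ} (y : Fin n → ℝ) : y ∈ lat n ↔ ∃ x : Fin n → ℤ, castV x = y := by
  constructor
  · intro h
    choose z hz using h
    exact ⟨z, by funext j; simp [castV, hz j]⟩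
  · rintro ⟨x, rfl⟩ j
    exact ⟨x j, rfl⟩

lemma intPts_eq {n m : ℕ} (A : Fin m → Fin n → ℝ) (b : Fin m → ℝ) (I : Set (Fin m)) :
    intPts (polyI A b I) = castV '' {x : Fin n → ℤ | ∀ i ∈ I, gval (A i) x ≤ b i} := by
  ext y
  simp only [intPts, Set.mem_inter_iff, mem_lat_iff, Set.mem_image, Set.mem_ofPred_eq]
  constructor
  · rintro ⟨h, x, rfl⟩
    exact ⟨x, h, rfl⟩
  · rintro ⟨x, h, rfl⟩
    exact ⟨h, x, rfl⟩

lemma gval_mid {n : ℕ} (a : Fin n → ℝ) (x y z : Fin n → ℤ) (h : ∀ j, 2 * z j = x j + y j) :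
    2 * gval a z = gval a x + gval a y := by
  unfold gval
  rw [Finset.mul_sum, ← Finset.sum_add_distrib]
  refine Finset.sum_congr rfl fun j _ => ?_
  have : (2 : ℝ) * z j = x j + y j := by exact_mod_cast h j
  linear_combination a j * this

/-- Families of up-sets covering the complement of `S` in `F`. -/
def GoodFam {n m : ℕ} (A : Fin m → Fin n → ℝ) (b : Fin m → ℝ) (I : Finset (Fin m))
    (F : Finset (Fin n → ℤ)) (U : Fin m → Finset (Fin n → ℤ)) : Prop :=
  (∀ i, U i ⊆ F ∧ (∀ x ∈ U i, b i < gval (A i) x) ∧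
    ∀ x ∈ U i, ∀ y ∈ F, gval (A i) x ≤ gval (A i) y → y ∈ U i) ∧
  ∀ x ∈ F, (∃ i ∈ I, b i < gval (A i) x) → ∃ i ∈ I, x ∈ U i

lemma exists_private {n m : ℕ} (A : Fin m → Fin n → ℝ) (b : Fin m → ℝ) (I : Finset (Fin m))
    (F : Finset (Fin n → ℤ))
    (hp : ∀ i ∈ I, ∃ x ∈ F, b i < gval (A i) x ∧ ∀ j ∈ I, j ≠ i → gval (A j) x ≤ b j) :
    ∃ (U : Fin m → Finset (Fin n → ℤ)) (p : Fin m → Fin n → ℤ), GoodFam A b I F U ∧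
      ∀ i ∈ I, p i ∈ U i ∧ (∀ j ∈ I, j ≠ i → p i ∉ U j) ∧
        ∀ y ∈ U i, gval (A i) (p i) ≤ gval (A i) y := by
  classical
  have hne : {U | GoodFam A b I F U}.Nonempty := by
    refine ⟨fun i => F.filter fun x => b i < gval (A i) x, ?_, ?_⟩
    · intro i
      refine ⟨Finset.filter_subset _ _, ?_, ?_⟩
      · intro x hx; exact (Finset.mem_filter.1 hx).2
      · intro x hx y hy hxy
        exact Finset.mem_filter.2 ⟨hy, lt_of_lt_of_le (Finset.mem_filter.1 hx).2 hxy⟩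
    · rintro x hx ⟨i, hi, h⟩
      exact ⟨i, hi, Finset.mem_filter.2 ⟨hx, h⟩⟩
  obtain ⟨U, hU, hmin⟩ := WellFounded.has_min
    (measure fun U : Fin m → Finset (Fin n → ℤ) => ∑ i, (U i).card).wf _ hne
  have key : ∀ i, ∃ q : Fin n → ℤ, i ∈ I → q ∈ U i ∧ (∀ j ∈ I, j ≠ i → q ∉ U j) ∧
        ∀ y ∈ U i, gval (A i) q ≤ gval (A i) y := by
    intro i
    by_cases hi : i ∈ I
    swap
    · exact ⟨0, fun h => absurd h hi⟩
    let P := (U i).filter fun x => ∀ j ∈ I, j ≠ i → x ∉ U j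
    have hP : P.Nonempty := by
      obtain ⟨x, hxF, hx, hxj⟩ := hp i hi
      obtain ⟨l, hl, hxl⟩ := hU.2 x hxF ⟨i, hi, hx⟩
      have hno : ∀ j ∈ I, j ≠ i → x ∉ U j := fun j hj hji hxU =>
        absurd ((hU.1 j).2.1 x hxU) (not_lt.2 (hxj j hj hji))
      have : l = i := by
        by_contra h
        exact hno l hl h hxl
      subst this
      exact ⟨x, Finset.mem_filter.2 ⟨hxl, hno⟩⟩
    obtain ⟨q, hqP, hq⟩ := Finset.exists_min_image P (fun x => gval (A i) x) hP
    have hqU := (Finset.mem_filter.1 hqP).1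
    refine ⟨q, fun _ => ⟨hqU, (Finset.mem_filter.1 hqP).2, ?_⟩⟩
    by_contra! hcon
    obtain ⟨y, hy, hyq⟩ := hcon
    let W := (U i).filter fun x => gval (A i) q ≤ gval (A i) x
    have hWU : W ⊆ U i := Finset.filter_subset _ _
    refine hmin (Function.update U i W) ⟨?_, ?_⟩ ?_
    · intro l
      by_cases hl : l = i
      · subst hl
        simp only [Function.update_self]
        refine ⟨hWU.trans (hU.1 l).1, fun x hx => (hU.1 l).2.1 x (hWU hx), ?_⟩
        intro x hx z hz hxz
        exact Finset.mem_filter.2 ⟨(hU.1 l).2.2 x (hWU hx) z hz hxz,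
          (Finset.mem_filter.1 hx).2.trans hxz⟩
      · simp only [Function.update_of_ne hl]
        exact hU.1 l
    · intro x hx hv
      obtain ⟨l, hl, hxl⟩ := hU.2 x hx hv
      by_cases hex : ∃ j ∈ I, j ≠ i ∧ x ∈ U j
      · obtain ⟨j, hj, hji, hxj⟩ := hex
        exact ⟨j, hj, by simpa only [Function.update_of_ne hji] using hxj⟩
      · push Not at hex
        have : l = i := by
          by_contra h
          exact hex l hl h hxl
        subst this
        refine ⟨l, hl, ?_⟩
        simp only [Function.update_self]
        exact Finset.mem_filter.2 ⟨hxl, hq x (Finset.mem_filter.2 ⟨hxl, hex⟩)⟩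
    · show ∑ l, (Function.update U i W l).card < ∑ l, (U l).card
      refine Finset.sum_lt_sum (fun l _ => ?_) ⟨i, Finset.mem_univ _, ?_⟩
      · by_cases hl : l = i
        · subst hl
          simp only [Function.update_self]
          exact Finset.card_le_card hWU
        · simp only [Function.update_of_ne hl]
          exact le_rfl
      · simp only [Function.update_self]
        refine Finset.card_lt_card ⟨hWU, fun h => ?_⟩
        exact absurd (Finset.mem_filter.1 (h hy)).2 (not_le.2 hyq)
  choose p hpp using key
  exact ⟨U, p, hU, hpp⟩

lemma helly_upper_aux {n m k : ℕ} (A : Fin m → Fin n → ℝ) (b : Fin m → ℝ) (I : Finset (Fin m))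
    (S : Finset (Fin n → ℤ)) (hS : S.card = k)
    (hSI : ∀ x, (∀ i ∈ I, gval (A i) x ≤ b i) → x ∈ S)
    (hp : ∀ i ∈ I, ∃ x, b i < gval (A i) x ∧ ∀ j ∈ I, j ≠ i → gval (A j) x ≤ b j) :
    I.card ≤ 2 ^ n * (k + 1) := by
  classical
  choose! p0 hp0 using hp
  let R : ℕ := ∑ i ∈ I, ∑ j, (p0 i j).natAbs
  let F : Finset (Fin n → ℤ) := Fintype.piFinset fun _ => Finset.Icc (-(R : ℤ)) R
  have hF : ∀ x : Fin n → ℤ, x ∈ F ↔ ∀ j, -(R : ℤ) ≤ x j ∧ x j ≤ R := by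
    intro x; simp [F, Fintype.mem_piFinset]
  obtain ⟨U, p, hU, hpU⟩ := exists_private A b I F (by
    intro i hi
    refine ⟨p0 i, ?_, hp0 i hi⟩
    rw [hF]
    intro j
    have h1 : (p0 i j).natAbs ≤ ∑ j, (p0 i j).natAbs :=
      Finset.single_le_sum (f := fun j => (p0 i j).natAbs) (fun _ _ => Nat.zero_le _)
        (Finset.mem_univ j)
    have h2 : ∑ j, (p0 i j).natAbs ≤ R :=
      Finset.single_le_sum (f := fun i => ∑ j, (p0 i j).natAbs) (fun _ _ => Nat.zero_le _) hi
    omega)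
  have hpF : ∀ i ∈ I, p i ∈ F := fun i hi => (hU.1 i).1 (hpU i hi).1
  by_contra! hlt
  obtain ⟨c, -, hc⟩ := Finset.exists_lt_card_fiber_of_mul_lt_card_of_maps_to
    (s := I) (t := (Finset.univ : Finset (Fin n → Fin 2)))
    (f := fun i j => if 2 ∣ p i j then 0 else 1) (n := k + 1) (fun _ _ => Finset.mem_univ _)
    (by simpa using hlt)
  set T := I.filter fun i => (fun j => if 2 ∣ p i j then (0 : Fin 2) else 1) = c with hT
  have hTn : T.Nonempty := Finset.card_pos.1 (by omega)
  obtain ⟨i0, hi0⟩ := hTn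
  have hi0I : i0 ∈ I := (Finset.mem_filter.1 hi0).1
  have hmid : ∀ i ∈ T, ∀ j, 2 * ((p i0 j + p i j) / 2) = p i0 j + p i j := by
    intro i hi j
    have h1 := congrFun (Finset.mem_filter.1 hi0).2 j
    have h2 := congrFun (Finset.mem_filter.1 hi).2 j
    rw [← h2] at h1
    have : (2 ∣ p i0 j) ↔ (2 ∣ p i j) := by
      by_cases ha : 2 ∣ p i0 j <;> by_cases hb : 2 ∣ p i j <;> simp [ha, hb] at h1 ⊢
    omega
  have hle : (T.erase i0).card ≤ S.card := by
    refine Finset.card_le_card_of_injOn (fun i j => (p i0 j + p i j) / 2) ?_ ?_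
    · intro i hi
      obtain ⟨hne, hiT⟩ := Finset.mem_erase.1 (Finset.mem_coe.1 hi)
      have hiI : i ∈ I := (Finset.mem_filter.1 hiT).1
      have hm := hmid i hiT
      show (fun j => (p i0 j + p i j) / 2) ∈ S
      set z : Fin n → ℤ := fun j => (p i0 j + p i j) / 2 with hz
      have hm' : ∀ j, 2 * z j = p i0 j + p i j := hm
      have hzF : z ∈ F := by
        rw [hF]; intro j
        have h1 := (hF _).1 (hpF i hiI) j
        have h2 := (hF _).1 (hpF i0 hi0I) j
        have := hm' j
        omega
      apply hSI
      by_contra! hcon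
      obtain ⟨l, hl, hzl⟩ := hU.2 z hzF hcon
      have hg := gval_mid (A l) _ _ z hm'
      by_cases h0 : l = i0
      · subst h0
        have h1 := (hpU l hl).2.2 z hzl
        have h2 : ¬ gval (A l) (p l) ≤ gval (A l) (p i) := fun h =>
          (hpU i hiI).2.1 l hl hne.symm ((hU.1 l).2.2 _ (hpU l hl).1 _ (hpF i hiI) h)
        linarith
      by_cases h0' : l = i
      · subst h0'
        have h1 := (hpU l hl).2.2 z hzl
        have h2 : ¬ gval (A l) (p l) ≤ gval (A l) (p i0) := fun h =>
          (hpU i0 hi0I).2.1 l hl hne ((hU.1 l).2.2 _ (hpU l hl).1 _ (hpF i0 hi0I) h)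
        linarith
      have h1 : ¬ gval (A l) z ≤ gval (A l) (p i0) := fun h =>
        (hpU i0 hi0I).2.1 l hl h0 ((hU.1 l).2.2 _ hzl _ (hpF i0 hi0I) h)
      have h2 : ¬ gval (A l) z ≤ gval (A l) (p i) := fun h =>
        (hpU i hiI).2.1 l hl h0' ((hU.1 l).2.2 _ hzl _ (hpF i hiI) h)
      linarith
    · intro i hi i' hi' heq
      have hiT := (Finset.mem_erase.1 (Finset.mem_coe.1 hi)).2
      have hiT' := (Finset.mem_erase.1 (Finset.mem_coe.1 hi')).2
      have hpe : p i = p i' := by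
        funext j
        have h1 := hmid i hiT j
        have h2 := hmid i' hiT' j
        have h3 : (p i0 j + p i j) / 2 = (p i0 j + p i' j) / 2 := congrFun heq j
        omega
      have hiI := (Finset.mem_filter.1 hiT).1
      have hiI' := (Finset.mem_filter.1 hiT').1
      by_contra hne
      exact (hpU i hiI).2.1 i' hiI' (Ne.symm hne) (hpe ▸ (hpU i' hiI').1)
  rw [Finset.card_erase_of_mem hi0] at hle
  omega

lemma helly_upper (n k : ℕ) : HellyBound n k (2 ^ n * (k + 1)) := by
  classical
  intro m A b hfin hcard
  have hne : {I : Finset (Fin m) |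
      intPts (polyI A b (↑I : Set (Fin m))) = intPts (polyI A b Set.univ)}.Nonempty :=
    ⟨Finset.univ, by simp⟩
  obtain ⟨I, hI, hmin⟩ := WellFounded.has_min
    (measure fun I : Finset (Fin m) => I.card).wf _ hne
  refine ⟨I, ?_, hI⟩
  have hI' : intPts (polyI A b (↑I : Set (Fin m))) = intPts (polyI A b Set.univ) := hI
  rw [← hI', intPts_eq] at hfin hcard
  have hfin' := hfin.of_finite_image castV_inj.injOn
  rw [Set.ncard_image_of_injective _ castV_inj, Set.ncard_eq_toFinset_card _ hfin'] at hcard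
  refine helly_upper_aux A b I hfin'.toFinset hcard ?_ ?_
  · intro x hx
    simpa using hx
  · intro i hi
    by_contra! hcon
    refine hmin (I.erase i) ?_ (Finset.card_erase_lt_of_mem hi)
    show intPts (polyI A b (↑(I.erase i) : Set (Fin m))) = intPts (polyI A b Set.univ)
    rw [← hI', intPts_eq, intPts_eq]
    congr 1
    ext x
    simp only [Finset.coe_erase, Set.mem_sdiff, Finset.mem_coe, Set.mem_singleton_iff,
      Set.mem_ofPred_eq]
    constructor
    · intro h
      by_cases hx : b i < gval (A i) x
      · obtain ⟨j, hj, hji, hlt⟩ := hcon x hx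
        exact absurd (h j ⟨hj, hji⟩) (not_le.2 hlt)
      · intro j hj
        by_cases hji : j = i
        · subst hji; exact not_lt.1 hx
        · exact h j ⟨hj, hji⟩
    · intro h j hj
      exact h j hj.1

lemma helly_int {n k c : ℕ} (h : HellyBound n k c) {ι : Type} [Fintype ι]
    (A : ι → Fin n → ℝ) (b : ι → ℝ) (T : Finset (Fin n → ℤ))
    (hT : ∀ x : Fin n → ℤ, (∀ i, gval (A i) x ≤ b i) ↔ x ∈ T) (hk : T.card = k) :
    ∃ I : Finset ι, I.card ≤ c ∧ ∀ x : Fin n → ℤ, (∀ i ∈ I, gval (A i) x ≤ b i) → x ∈ T := by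
  classical
  let e := Fintype.equivFin ι
  have hset : {x : Fin n → ℤ | ∀ i ∈ (Set.univ : Set (Fin (Fintype.card ι))),
      gval (A (e.symm i)) x ≤ b (e.symm i)} = ↑T := by
    ext x
    simp only [Set.mem_ofPred_eq, Set.mem_univ, true_imp_iff, Finset.mem_coe]
    rw [← hT]
    exact ⟨fun h i => by simpa using h (e i), fun h i => h _⟩
  have heq := intPts_eq (fun i => A (e.symm i)) (fun i => b (e.symm i)) Set.univ
  rw [hset] at heq
  obtain ⟨I, hIc, hI⟩ := h _ (fun i => A (e.symm i)) (fun i => b (e.symm i))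
    (by rw [heq]; exact T.finite_toSet.image _)
    (by rw [heq, Set.ncard_image_of_injective _ castV_inj, Set.ncard_coe_finset, hk])
  refine ⟨I.map e.symm.toEmbedding, by simpa using hIc, ?_⟩
  intro x hx
  rw [heq, intPts_eq] at hI
  have : castV x ∈ castV '' (↑T : Set (Fin n → ℤ)) := by
    rw [← hI]
    refine ⟨x, fun i hi => hx _ ?_, rfl⟩
    simpa using hi
  simpa [castV_inj.mem_set_image] using this

/-- Sum of squares of the coordinates. -/
def qsum {d N : ℕ} (y : Fin d → Fin N) : ℕ := ∑ i, (y i : ℕ) ^ 2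

/-- The base-`N` code of a point of the box. -/
def codeN {d N : ℕ} (y : Fin d → Fin N) : ℕ := ∑ i, (y i : ℕ) * N ^ (i : ℕ)

lemma codeN_eq {d N : ℕ} (y : Fin d → Fin N) : codeN y = (finFunctionFinEquiv y : ℕ) := by
  simp [codeN]

lemma codeN_lt {d N : ℕ} (y : Fin d → Fin N) : codeN y < N ^ d := by
  rw [codeN_eq]; exact (finFunctionFinEquiv y).2

lemma codeN_inj {d N : ℕ} (y z : Fin d → Fin N) (h : codeN y = codeN z) : y = z := by
  rw [codeN_eq, codeN_eq] at h
  exact finFunctionFinEquiv.injective (Fin.ext h)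

lemma qsum_le {d N : ℕ} (y : Fin d → Fin N) : qsum y ≤ d * (N - 1) ^ 2 := by
  unfold qsum
  calc ∑ i, (y i : ℕ) ^ 2 ≤ ∑ _i : Fin d, (N - 1) ^ 2 :=
        Finset.sum_le_sum fun i _ => Nat.pow_le_pow_left (by have := (y i).2; omega) 2
    _ = _ := by simp

/-- The points of the polyhedron. -/
def Qset (d N M : ℕ) : Finset ((Fin d → Fin N) × ℕ) :=
  (Finset.univ ×ˢ Finset.range (M + 1)).filter fun p =>
    qsum p.1 + 1 ≤ p.2 ∧ N ^ d * p.2 + codeN p.1 ≤ M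

lemma mem_Qset {d N M : ℕ} (p : (Fin d → Fin N) × ℕ) :
    p ∈ Qset d N M ↔ qsum p.1 + 1 ≤ p.2 ∧ N ^ d * p.2 + codeN p.1 ≤ M := by
  simp only [Qset, Finset.mem_filter, Finset.mem_product, Finset.mem_univ, true_and,
    Finset.mem_range, and_iff_right_iff_imp]
  rintro ⟨-, h⟩
  have h1 := codeN_lt p.1
  have : 1 * p.2 ≤ N ^ d * p.2 := Nat.mul_le_mul_right _ (by omega)
  omega

lemma Qset_step (d N M : ℕ) : (Qset d N (M + 1)).card ≤ (Qset d N M).card + 1 := by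
  classical
  have hsub : Qset d N M ⊆ Qset d N (M + 1) := by
    intro p hp
    rw [mem_Qset] at hp ⊢
    omega
  have : (Qset d N (M + 1) \ Qset d N M).card ≤ 1 := by
    rw [Finset.card_le_one]
    rintro ⟨y, t⟩ h ⟨z, s⟩ h'
    simp only [Finset.mem_sdiff, mem_Qset] at h h'
    have h1 := codeN_lt y
    have h2 := codeN_lt z
    have e : N ^ d * t + codeN y = N ^ d * s + codeN z := by omega
    have ets : t = s := by
      have := congrArg (· / N ^ d) e
      simpa [Nat.mul_add_div (show 0 < N ^ d by omega), Nat.div_eq_of_lt h1,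
        Nat.div_eq_of_lt h2] using this
    subst ets
    rw [codeN_inj y z (by omega)]
  have h3 := Finset.card_sdiff_add_card_eq_card hsub
  omega

lemma Qset_init (d N : ℕ) (hN : 1 ≤ N) :
    (Qset d N (N ^ d * (d * (N - 1) ^ 2) + N ^ d - 1)).card ≤ N ^ d * (d * (N - 1) ^ 2) := by
  classical
  have hpos : 0 < N ^ d := Nat.pow_pos hN
  have hsub : Qset d N (N ^ d * (d * (N - 1) ^ 2) + N ^ d - 1) ⊆
      Finset.univ ×ˢ Finset.Icc 1 (d * (N - 1) ^ 2) := by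
    rintro ⟨y, t⟩ h
    rw [mem_Qset] at h
    dsimp only at h
    simp only [Finset.mem_product, Finset.mem_univ, true_and, Finset.mem_Icc]
    refine ⟨by omega, ?_⟩
    have : N ^ d * t < N ^ d * (d * (N - 1) ^ 2 + 1) := by
      rw [Nat.mul_add]; omega
    have := Nat.lt_of_mul_lt_mul_left this
    omega
  refine (Finset.card_le_card hsub).trans ?_
  simp

lemma Qset_large (d N K : ℕ) (hN : 1 ≤ N) : K ≤ (Qset d N (N ^ d * K)).card := by
  classical
  let o : Fin d → Fin N := fun _ => ⟨0, hN⟩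
  have hq : qsum o = 0 := by simp [qsum, o]
  have hc : codeN o = 0 := by simp [codeN, o]
  calc K = (Finset.Icc 1 K).card := by simp
    _ ≤ _ := by
      refine Finset.card_le_card_of_injOn (fun t => (o, t)) ?_ ?_
      · intro t ht
        have ht' := Finset.mem_Icc.1 (Finset.mem_coe.1 ht)
        rw [Finset.mem_coe, mem_Qset]
        simp only [hq, hc]
        exact ⟨by omega, by simpa using Nat.mul_le_mul_left _ ht'.2⟩
      · intro a _ b _ h
        exact (Prod.ext_iff.1 h).2

lemma Qset_mono (d N : ℕ) {M M' : ℕ} (h : M ≤ M') : Qset d N M ⊆ Qset d N M' := by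
  intro p hp
  rw [mem_Qset] at hp ⊢
  omega

lemma exists_M (d N k : ℕ) (hN : 1 ≤ N) (hk : N ^ d * (d * (N - 1) ^ 2) ≤ k) :
    ∃ M, N ^ d * (d * (N - 1) ^ 2) + N ^ d - 1 ≤ M ∧ (Qset d N M).card = k := by
  classical
  set M0 := N ^ d * (d * (N - 1) ^ 2) + N ^ d - 1 with hM0
  have h0 : (Qset d N M0).card ≤ k := (Qset_init d N hN).trans hk
  have hex : ∃ j, k ≤ (Qset d N (M0 + j)).card :=
    ⟨N ^ d * k, (Qset_large d N k hN).trans (Finset.card_le_card (Qset_mono d N (by omega)))⟩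
  refine ⟨M0 + Nat.find hex, by omega, le_antisymm ?_ (Nat.find_spec hex)⟩
  rcases hj : Nat.find hex with _ | j
  · simpa using h0
  · have h1 := Nat.find_min hex (m := j) (by omega)
    have h2 := Qset_step d N (M0 + j)
    rw [← add_assoc]
    omega

lemma gval_cons {d : ℕ} (a0 : ℝ) (a : Fin d → ℝ) (z : Fin (d + 1) → ℤ) :
    gval (Fin.cons a0 a : Fin (d + 1) → ℝ) z = a0 * z 0 + ∑ i, a i * z i.succ := by
  simp [gval, Fin.sum_univ_succ]

/-- Index type of the system. -/
abbrev Idx (d N : ℕ) : Type := (Fin d → Fin N) ⊕ ((Fin d ⊕ Fin d) ⊕ Unit)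

/-- Coefficients of the system. -/
def sysA (d N : ℕ) : Idx d N → Fin (d + 1) → ℝ
  | Sum.inl x => Fin.cons (-1) fun i => 2 * ((x i : ℕ) : ℝ)
  | Sum.inr (Sum.inl (Sum.inl i)) => Fin.cons 0 (Pi.single i (-1))
  | Sum.inr (Sum.inl (Sum.inr i)) => Fin.cons 0 (Pi.single i 1)
  | Sum.inr (Sum.inr _) => Fin.cons ((N : ℝ) ^ d) fun i => (N : ℝ) ^ (i : ℕ)

/-- Right-hand sides of the system. -/
def sysb (d N M : ℕ) : Idx d N → ℝ
  | Sum.inl x => (qsum x : ℝ) - 1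
  | Sum.inr (Sum.inl (Sum.inl _)) => 0
  | Sum.inr (Sum.inl (Sum.inr _)) => (N : ℝ) - 1
  | Sum.inr (Sum.inr _) => (M : ℝ)

/-- Embedding of the points in the integer lattice. -/
def embV {d N : ℕ} (p : (Fin d → Fin N) × ℕ) : Fin (d + 1) → ℤ :=
  Fin.cons (p.2 : ℤ) fun i => ((p.1 i : ℕ) : ℤ)

lemma embV_inj {d N : ℕ} : Function.Injective (embV (d := d) (N := N)) := by
  rintro ⟨y, t⟩ ⟨z, s⟩ h
  have h0 := congrFun h 0
  simp only [embV, Fin.cons_zero] at h0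
  refine Prod.ext (funext fun i => ?_) (by exact_mod_cast h0)
  have h1 := congrFun h i.succ
  simp only [embV, Fin.cons_succ] at h1
  exact Fin.ext (by exact_mod_cast h1)

lemma sys_inl {d N M : ℕ} (x y : Fin d → Fin N) (t : ℕ) :
    gval (sysA d N (Sum.inl x)) (embV (y, t)) ≤ sysb d N M (Sum.inl x) ↔
      (qsum y : ℤ) + 1 ≤ t + ∑ i, (((x i : ℕ) : ℤ) - ((y i : ℕ) : ℤ)) ^ 2 := by
  simp only [sysA, sysb, gval_cons, embV, Fin.cons_zero, Fin.cons_succ]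
  have e : (∑ i, (((x i : ℕ) : ℤ) - ((y i : ℕ) : ℤ)) ^ 2) =
      qsum x + qsum y - ∑ i, 2 * ((x i : ℕ) : ℤ) * ((y i : ℕ) : ℤ) := by
    simp only [qsum]
    push_cast
    rw [← Finset.sum_add_distrib, ← Finset.sum_sub_distrib]
    exact Finset.sum_congr rfl fun i _ => by ring
  rw [e]
  have c : (∑ i, 2 * ((x i : ℕ) : ℝ) * (((y i : ℕ) : ℤ) : ℝ)) =
      ((∑ i, 2 * ((x i : ℕ) : ℤ) * ((y i : ℕ) : ℤ) : ℤ) : ℝ) := by push_cast; rfl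
  rw [c]
  generalize (∑ i, 2 * ((x i : ℕ) : ℤ) * ((y i : ℕ) : ℤ)) = w
  rw [← Int.cast_le (R := ℝ)]
  push_cast
  constructor <;> intro h <;> linarith

lemma sys_top {d N M : ℕ} (y : Fin d → Fin N) (t : ℕ) :
    gval (sysA d N (Sum.inr (Sum.inr ()))) (embV (y, t)) ≤ sysb d N M (Sum.inr (Sum.inr ())) ↔
      N ^ d * t + codeN y ≤ M := by
  simp only [sysA, sysb, gval_cons, embV, Fin.cons_zero, Fin.cons_succ, codeN]
  rw [← Nat.cast_le (α := ℝ)]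
  push_cast
  simp only [mul_comm]

lemma sys_lo {d N M : ℕ} (i : Fin d) (z : Fin (d + 1) → ℤ) :
    gval (sysA d N (Sum.inr (Sum.inl (Sum.inl i)))) z ≤ sysb d N M (Sum.inr (Sum.inl (Sum.inl i)))
      ↔ 0 ≤ z i.succ := by
  simp [sysA, sysb, gval_cons, Pi.single_apply]

lemma sys_hi {d N M : ℕ} (i : Fin d) (z : Fin (d + 1) → ℤ) :
    gval (sysA d N (Sum.inr (Sum.inl (Sum.inr i)))) z ≤ sysb d N M (Sum.inr (Sum.inl (Sum.inr i)))
      ↔ z i.succ + 1 ≤ N := by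
  simp only [sysA, sysb, gval_cons, Pi.single_apply]
  rw [← Int.cast_le (R := ℝ)]
  push_cast
  simp [le_sub_iff_add_le]

lemma sys_inl_self {d N M : ℕ} (x : Fin d → Fin N) (z : Fin (d + 1) → ℤ)
    (hz : ∀ i, z i.succ = ((x i : ℕ) : ℤ))
    (h : gval (sysA d N (Sum.inl x)) z ≤ sysb d N M (Sum.inl x)) : (qsum x : ℤ) + 1 ≤ z 0 := by
  simp only [sysA, sysb, gval_cons, hz] at h
  have c : (∑ i, 2 * ((x i : ℕ) : ℝ) * (((x i : ℕ) : ℤ) : ℝ)) = 2 * (qsum x : ℝ) := by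
    simp only [qsum]
    push_cast
    rw [Finset.mul_sum]
    exact Finset.sum_congr rfl fun i _ => by ring
  rw [c] at h
  rw [← Int.cast_le (R := ℝ)]
  push_cast
  linarith

lemma sys_iff (d N M : ℕ) (z : Fin (d + 1) → ℤ) :
    (∀ i, gval (sysA d N i) z ≤ sysb d N M i) ↔ z ∈ (Qset d N M).image embV := by
  classical
  rw [Finset.mem_image]
  constructor
  · intro h
    have hlo := fun i => (sys_lo (M := M) i z).1 (h _)
    have hhi := fun i => (sys_hi (M := M) i z).1 (h _)
    let y : Fin d → Fin N := fun i => ⟨(z i.succ).toNat, by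
      have := hlo i; have := hhi i; omega⟩
    have hy : ∀ i, z i.succ = ((y i : ℕ) : ℤ) := fun i => by
      have := hlo i
      simp only [y]
      omega
    have h0 := sys_inl_self y z hy (h (Sum.inl y))
    have hz : embV (y, (z 0).toNat) = z := by
      funext j
      refine Fin.cases ?_ (fun i => ?_) j
      · simp only [embV, Fin.cons_zero]; omega
      · simp only [embV, Fin.cons_succ]; exact (hy i).symm
    refine ⟨(y, (z 0).toNat), ?_, hz⟩
    rw [mem_Qset]
    refine ⟨by simp only; omega, ?_⟩
    have h1 := h (Sum.inr (Sum.inr ()))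
    rw [← hz] at h1
    exact sys_top _ _ |>.1 h1
  · rintro ⟨⟨y, t⟩, hp, rfl⟩
    rw [mem_Qset] at hp
    rintro (x | (i | i) | u)
    · rw [sys_inl]
      have : 0 ≤ ∑ i, (((x i : ℕ) : ℤ) - ((y i : ℕ) : ℤ)) ^ 2 :=
        Finset.sum_nonneg fun i _ => sq_nonneg _
      have := hp.1
      simp only at this
      omega
    · rw [sys_lo]; simp [embV]
    · rw [sys_hi]; simp only [embV, Fin.cons_succ]; have := (y i).2; omega
    · exact (sys_top y t).2 hp.2

lemma helly_lower {d N k c : ℕ} (hN : 1 ≤ N) (hk : N ^ d * (d * (N - 1) ^ 2) ≤ k)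
    (h : HellyBound (d + 1) k c) : N ^ d ≤ c := by
  classical
  obtain ⟨M, hM, hcard⟩ := exists_M d N k hN hk
  obtain ⟨I, hIc, hI⟩ := helly_int h (sysA d N) (sysb d N M) ((Qset d N M).image embV)
    (sys_iff d N M) (by rw [Finset.card_image_of_injective _ embV_inj, hcard])
  have hall : ∀ x : Fin d → Fin N, (Sum.inl x : Idx d N) ∈ I := by
    intro x
    by_contra hx
    have hmem := hI (embV (x, qsum x)) (by
      rintro (x' | (i | i) | u) hi
      · rw [sys_inl]
        have hne : x' ≠ x := fun e => hx (e ▸ hi)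
        obtain ⟨i, hi'⟩ := Function.ne_iff.1 hne
        have h1 : (((x' i : ℕ) : ℤ) - ((x i : ℕ) : ℤ)) ^ 2 ≤
            ∑ i, (((x' i : ℕ) : ℤ) - ((x i : ℕ) : ℤ)) ^ 2 :=
          Finset.single_le_sum (f := fun i => (((x' i : ℕ) : ℤ) - ((x i : ℕ) : ℤ)) ^ 2)
            (fun _ _ => sq_nonneg _) (Finset.mem_univ i)
        have h2 : 0 < (((x' i : ℕ) : ℤ) - ((x i : ℕ) : ℤ)) ^ 2 := by
          have : ((x' i : ℕ) : ℤ) - ((x i : ℕ) : ℤ) ≠ 0 := by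
            intro e
            exact hi' (Fin.ext (by omega))
          positivity
        omega
      · rw [sys_lo]; simp [embV]
      · rw [sys_hi]; simp only [embV, Fin.cons_succ]; have := (x i).2; omega
      · refine (sys_top x _).2 ?_
        have h1 := codeN_lt x
        have h2 := Nat.mul_le_mul_left (N ^ d) (qsum_le x)
        omega)
    obtain ⟨p, hp, he⟩ := Finset.mem_image.1 hmem
    rw [embV_inj he, mem_Qset] at hp
    simp only at hp
    omega
  have : (Finset.univ : Finset (Fin d → Fin N)).card ≤ I.card :=
    Finset.card_le_card_of_injOn Sum.inl (fun x _ => hall x) (fun a _ b _ e => Sum.inl_injective e)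
  simp only [Finset.card_univ, Fintype.card_fun, Fintype.card_fin] at this
  omega

/-- For each `n ≥ 2` there is `C > 0` (depending only on `n`)
with `c(n,k) ≥ C·k^{(n−1)/(n+1)}` for all `k ≥ 1`. -/
theorem stmt14 (n : ℕ) (hn : 2 ≤ n) :
    ∃ C : ℝ, 0 < C ∧ ∀ k : ℕ, 1 ≤ k →
      C * (k : ℝ) ^ (((n : ℝ) - 1) / ((n : ℝ) + 1)) ≤ (cnk n k : ℝ) := by
  obtain ⟨d, rfl⟩ : ∃ d, n = d + 1 := ⟨n - 1, by omega⟩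
  have hd : 1 ≤ d := by omega
  set e : ℝ := ((d + 1 : ℕ) - 1 : ℝ) / ((d + 1 : ℕ) + 1 : ℝ) with he
  have he' : e = (d : ℝ) / (d + 2) := by rw [he]; push_cast; ring_nf
  have he0 : 0 ≤ e := by rw [he']; positivity
  have hD : (0 : ℝ) < 2 ^ d * d := by positivity
  refine ⟨((2 ^ d * d : ℝ) ^ e)⁻¹, by positivity, ?_⟩
  intro k hk
  have hmem : HellyBound (d + 1) k (cnk (d + 1) k) :=
    Nat.sInf_mem (s := {c | HellyBound (d + 1) k c}) ⟨_, helly_upper (d + 1) k⟩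
  have hex : ∃ N, k < (N + 1) ^ d * (d * N ^ 2) := by
    refine ⟨k + 1, ?_⟩
    have h1 : 0 < (k + 1 + 1) ^ d := by positivity
    have h2 : k + 1 ≤ d * (k + 1) ^ 2 := by nlinarith
    nlinarith
  classical
  obtain ⟨N, hN, hNk, hkN⟩ : ∃ N, 1 ≤ N ∧ N ^ d * (d * (N - 1) ^ 2) ≤ k ∧
      k < (N + 1) ^ d * (d * N ^ 2) := by
    have hs := Nat.find_spec hex
    rcases hj : Nat.find hex with _ | j
    · rw [hj] at hs; simp at hs
    · rw [hj] at hs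
      have hm := Nat.find_min hex (m := j) (by omega)
      exact ⟨j + 1, by omega, by simpa using hm, hs⟩
  have hlow : N ^ d ≤ cnk (d + 1) k := helly_lower hN hNk hmem
  have hle : (k : ℝ) ≤ (2 ^ d * d) * (N : ℝ) ^ (d + 2) := by
    have h1 : (N + 1) ^ d ≤ (2 * N) ^ d := Nat.pow_le_pow_left (by omega) d
    have h2 : k ≤ (2 * N) ^ d * (d * N ^ 2) := hkN.le.trans (Nat.mul_le_mul_right _ h1)
    have h3 : (k : ℝ) ≤ (2 * N) ^ d * (d * N ^ 2) := by exact_mod_cast h2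
    calc (k : ℝ) ≤ _ := h3
      _ = _ := by rw [mul_pow, pow_add]; ring
  have hpow : ((N : ℝ) ^ (d + 2)) ^ e = (N : ℝ) ^ d := by
    rw [← Real.rpow_natCast, ← Real.rpow_mul (by positivity), he', ← Real.rpow_natCast]
    congr 1
    push_cast
    field_simp
  have hfin : (k : ℝ) ^ e ≤ (2 ^ d * d : ℝ) ^ e * (N : ℝ) ^ d := by
    calc (k : ℝ) ^ e ≤ ((2 ^ d * d) * (N : ℝ) ^ (d + 2)) ^ e :=
          Real.rpow_le_rpow (by positivity) hle he0
      _ = _ := by rw [Real.mul_rpow hD.le (by positivity), hpow]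
  rw [inv_mul_le_iff₀ (by positivity)]
  refine hfin.trans (mul_le_mul_of_nonneg_left ?_ (by positivity))
  exact_mod_cast hlow
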